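/- arXiv:1811.01421 — 2 statements merged into one kernel-verified Lean document; each statement's English description precedes it below -/
import Mathlib

section
/- Let C be a configuration of an NIS protocol in which every active process is poised to update the same snapshot object, let β be a 1-round schedule from C, let α be a prefix of β, and let P be the set of processes that occur twice in α. Then Cα and Cβ are indistinguishable to P and to the processes that are terminated in C. -/
set_option linter.dupNamespace false

namespace EBP

/-- States of a process in the NIS model: its initial state `(i, x)`, the state
after performing an `update` (the previous state plus a bit recording the
update), and the state `(i, r, v)` after a `scan` of the snapshot object `S_r`,
where `v` is the result of the scan. -/
inductive PState (n : ℕ) (I : Type) : Type where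
  | init : Fin n → I → PState n I
  | upd : PState n I → PState n I
  | scanned : Fin n → ℕ → (Fin n → Option (PState n I)) → PState n I

namespace PState

/-- The identifier of the process whose state this is. -/
def pid {n : ℕ} {I : Type} : PState n I → Fin n
  | init i _ => i
  | upd s => pid s
  | scanned i _ _ => i

/-- The index of the next snapshot object this state is due to update
(the number of completed scans). -/
def rounds {n : ℕ} {I : Type} : PState n I → ℕ
  | init _ _ => 0
  | upd s => rounds s
  | scanned _ r _ => r + 1

/-- Whether the state has performed its `update` to its current snapshot object
but not yet its `scan`. -/
def hasUpd {n : ℕ} {I : Type} : PState n I → Bool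
  | upd _ => true
  | _ => false

/-- Whether this state is the result of a `scan`. -/
def isScanned {n : ℕ} {I : Type} : PState n I → Bool
  | scanned _ _ _ => true
  | _ => false

end PState

/-- A configuration: the contents of each component of each snapshot object
(`mem r i` is component `i` of `S_r`), and the state of each process. -/
structure Config (n : ℕ) (I : Type) where
  mem : ℕ → Fin n → Option (PState n I)
  st : Fin n → PState n I

/-- The initial configuration with input `x i` for process `i`. -/
def initConfig {n : ℕ} {I : Type} (x : Fin n → I) : Config n I where
  mem := fun _ _ => none
  st := fun i => PState.init i (x i)

/-- One step of process `i`: an `update` writing its current state to its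
snapshot object if it has not updated it yet, and otherwise a `scan`. -/
def stepc {n : ℕ} {I : Type} (C : Config n I) (i : Fin n) : Config n I :=
  match C.st i with
  | PState.upd s =>
      { C with st := Function.update C.st i (PState.scanned i s.rounds (C.mem s.rounds)) }
  | s =>
      { mem := Function.update C.mem s.rounds (Function.update (C.mem s.rounds) i (some s)),
        st := Function.update C.st i (PState.upd s) }

/-- Running a schedule from a configuration. -/
def runSched {n : ℕ} {I : Type} (C : Config n I) : List (Fin n) → Config n I
  | [] => C
  | i :: l => runSched (stepc C i) l

/-- `l` is a schedule from `C` for the protocol `δ`: every process is active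
(has not terminated) when it takes its step. -/
def IsSched {n : ℕ} {I O : Type} (δ : PState n I → Option O) :
    Config n I → List (Fin n) → Prop
  | _, [] => True
  | C, i :: l => δ (C.st i) = none ∧ IsSched δ (stepc C i) l

/-- `l` is a 1-round schedule from `C`: a schedule consisting of exactly two
occurrences of each process that is active in `C`. -/
def IsOneRound {n : ℕ} {I O : Type} (δ : PState n I → Option O) (C : Config n I)
    (l : List (Fin n)) : Prop :=
  IsSched δ C l ∧ ∀ i, l.count i = if (δ (C.st i)).isNone then 2 else 0

/-- `l` is an `r`-round schedule from `C`. -/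
def IsRounds {n : ℕ} {I O : Type} (δ : PState n I → Option O) :
    Config n I → ℕ → List (Fin n) → Prop
  | _, 0, l => l = []
  | C, r + 1, l => ∃ l₁ l₂, l = l₁ ++ l₂ ∧ IsOneRound δ C l₁ ∧ IsRounds δ (runSched C l₁) r l₂

/-- Process `i` is poised to perform an `update` to the snapshot object `S_r`
in configuration `C`. -/
def PoisedUpdate {n : ℕ} {I : Type} (C : Config n I) (i : Fin n) (r : ℕ) : Prop :=
  (C.st i).hasUpd = false ∧ (C.st i).rounds = r

theorem stepc_st_of_ne {n : ℕ} {I : Type} (C : Config n I) {i j : Fin n} (h : i ≠ j) :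
    (stepc C j).st i = C.st i := by
  unfold stepc
  split <;> exact Function.update_of_ne h _ _

theorem runSched_append {n : ℕ} {I : Type} (C : Config n I) (l₁ l₂ : List (Fin n)) :
    runSched C (l₁ ++ l₂) = runSched (runSched C l₁) l₂ := by
  induction l₁ generalizing C with
  | nil => rfl
  | cons j l ih => exact ih (stepc C j)

theorem runSched_st_of_notMem {n : ℕ} {I : Type} (C : Config n I) {i : Fin n}
    {l : List (Fin n)} (h : i ∉ l) : (runSched C l).st i = C.st i := by
  induction l generalizing C with
  | nil => rfl
  | cons j l ih =>
    rw [List.mem_cons, not_or] at h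
    exact (ih (stepc C j) h.2).trans (stepc_st_of_ne C h.1)

/-- Let `C` be a configuration of an NIS protocol in which
every active process is poised to update the same snapshot object, let `β` be a
1-round schedule from `C`, let `α` be a prefix of `β`, and let `P` be the set of
processes that occur twice in `α`. Then `Cα` and `Cβ` are indistinguishable to
`P` and to the processes that are terminated in `C`. -/
theorem one_round_prefix_indistinguishable {n : ℕ} {I O : Type}
    (δ : PState n I → Option O)
    (hδ : ∀ s : PState n I, δ s ≠ none → s.isScanned = true)
    (C : Config n I) (t : ℕ)
    (hpoised : ∀ i, δ (C.st i) = none → PoisedUpdate C i t)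
    (β : List (Fin n)) (hβ : IsOneRound δ C β)
    (α : List (Fin n)) (hpre : α <+: β) :
    ∀ i : Fin n, (α.count i = 2 ∨ δ (C.st i) ≠ none) →
      (runSched C α).st i = (runSched C β).st i := by
  obtain ⟨γ, rfl⟩ := hpre
  intro i hi
  have hcount := hβ.2 i
  rw [List.count_append] at hcount
  have hγ : γ.count i = 0 := by
    rcases hi with h | h
    · split at hcount <;> omega
    · rw [if_neg (by simpa using h)] at hcount
      omega
  rw [runSched_append, runSched_st_of_notMem _ (List.count_eq_zero.mp hγ)]

end EBP
end

section
/- Let σ be an n-vertex clique that represents a configuration C of an NIS protocol in which every active process is poised to update the snapshot object S_{t+1}. Then every n-vertex clique of χ(σ,δ) represents a configuration reachable from C by a 1-round schedule. -/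
set_option linter.dupNamespace false

namespace EBP

/-- A graph on a vertex universe `V`: a vertex set together with a symmetric
adjacency relation supported on the vertex set. -/
structure PGraph (V : Type) where
  verts : Set V
  Adj : V → V → Prop
  symm : ∀ u v, Adj u v → Adj v u
  adj_mem : ∀ u v, Adj u v → u ∈ verts ∧ v ∈ verts

variable {V O : Type}

/-- `σ` is an `n`-vertex clique of `G`: `n` pairwise adjacent vertices with
pairwise distinct identifiers. -/
def IsNClique (n : ℕ) (G : PGraph V) (idv : V → Fin n) (σ : Set V) : Prop :=
  σ ⊆ G.verts ∧ σ.Finite ∧ σ.ncard = n ∧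
    (∀ u ∈ σ, ∀ v ∈ σ, u ≠ v → G.Adj u v) ∧ Set.InjOn idv σ

/-- `G` is a union of `n`-vertex cliques: every vertex and every edge is
contained in some `n`-vertex clique. -/
def IsCliqueUnionGraph (n : ℕ) (G : PGraph V) (idv : V → Fin n) : Prop :=
  (∀ v ∈ G.verts, ∃ σ, IsNClique n G idv σ ∧ v ∈ σ) ∧
    (∀ u v, G.Adj u v → ∃ σ, IsNClique n G idv σ ∧ u ∈ σ ∧ v ∈ σ)

/-- A set `A` of vertices of `G` is a union of `n`-vertex cliques of `G`. -/
def IsCliqueUnionSet (n : ℕ) (G : PGraph V) (idv : V → Fin n) (A : Set V) : Prop :=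
  ∀ v ∈ A, ∃ σ, IsNClique n G idv σ ∧ σ ⊆ A ∧ v ∈ σ

/-- The vertex universe of the subdivision: old vertices (only terminated ones
are used) together with pairs `(i, τ)`. -/
abbrev SubV (V : Type) (n : ℕ) : Type := V ⊕ (Fin n × Set V)

/-- Identifier of a subdivision vertex. -/
def subId (n : ℕ) (idv : V → Fin n) : SubV V n → Fin n
  | Sum.inl v => idv v
  | Sum.inr p => p.1

/-- Status of a subdivision vertex: old terminated vertices keep their output;
every pair `(i, τ)` is active. -/
def subStatus (n : ℕ) (δ : V → Option O) : SubV V n → Option O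
  | Sum.inl v => δ v
  | Sum.inr _ => none

/-- Vertices of the subdivision `χ(σ,δ)` of an `n`-vertex clique `σ`:
the terminated vertices of `σ` together with all pairs `(i,τ)` where `τ` is a
subset of the active vertices of `σ` and `i ∈ id(τ)`. -/
def chiVerts (n : ℕ) (δ : V → Option O) (idv : V → Fin n) (σ : Set V) : Set (SubV V n) :=
  {x | ∃ v ∈ σ, δ v ≠ none ∧ x = Sum.inl v} ∪
    {x | ∃ i τ, τ ⊆ {v ∈ σ | δ v = none} ∧ (∃ w ∈ τ, idv w = i) ∧ x = Sum.inr (i, τ)}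

/-- Adjacency in the subdivision `χ(σ,δ)`. -/
def chiAdj (n : ℕ) (δ : V → Option O) (idv : V → Fin n) (σ : Set V) (x y : SubV V n) : Prop :=
  x ∈ chiVerts n δ idv σ ∧ y ∈ chiVerts n δ idv σ ∧ subId n idv x ≠ subId n idv y ∧
    ((∃ v, x = Sum.inl v) ∨ (∃ v, y = Sum.inl v) ∨
      (∃ i τ j ρ, x = Sum.inr (i, τ) ∧ y = Sum.inr (j, ρ) ∧ (τ ⊆ ρ ∨ ρ ⊆ τ)))

theorem chiAdj_symm {n : ℕ} {δ : V → Option O} {idv : V → Fin n} {σ : Set V}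
    {x y : SubV V n} (h : chiAdj n δ idv σ x y) : chiAdj n δ idv σ y x := by
  obtain ⟨hx, hy, hne, hc⟩ := h
  refine ⟨hy, hx, hne.symm, ?_⟩
  rcases hc with h | h | ⟨i, τ, j, ρ, hx', hy', hs⟩
  · exact Or.inr (Or.inl h)
  · exact Or.inl h
  · exact Or.inr (Or.inr ⟨j, ρ, i, τ, hy', hx', hs.symm⟩)

/-- The subdivision `χ(σ,δ)` of an `n`-vertex clique `σ`, as a graph. -/
def chiCliqueGraph (n : ℕ) (δ : V → Option O) (idv : V → Fin n) (σ : Set V) :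
    PGraph (SubV V n) where
  verts := chiVerts n δ idv σ
  Adj := chiAdj n δ idv σ
  symm := fun _ _ h => chiAdj_symm h
  adj_mem := fun _ _ h => ⟨h.1, h.2.1⟩

/-- The subdivision `χ(G,δ)` of a graph `G` that is a union of `n`-vertex
cliques: the union of the subdivisions of all its `n`-vertex cliques. -/
def chiGraph (n : ℕ) (G : PGraph V) (δ : V → Option O) (idv : V → Fin n) :
    PGraph (SubV V n) where
  verts := {x | ∃ σ, IsNClique n G idv σ ∧ x ∈ chiVerts n δ idv σ}
  Adj x y := ∃ σ, IsNClique n G idv σ ∧ chiAdj n δ idv σ x y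
  symm := fun _ _ h => h.elim fun σ hσ => ⟨σ, hσ.1, chiAdj_symm hσ.2⟩
  adj_mem := fun _ _ h => h.elim fun σ hσ => ⟨⟨σ, hσ.1, hσ.2.1⟩, ⟨σ, hσ.1, hσ.2.2.1⟩⟩

/-- The subdivision of a set `A` of vertices that is a union of `n`-vertex
cliques of `G`: the union of the subdivisions of the `n`-vertex cliques of `G`
contained in `A`. -/
def chiSetCliques (n : ℕ) (G : PGraph V) (δ : V → Option O) (idv : V → Fin n) (A : Set V) :
    Set (SubV V n) :=
  {x | ∃ σ, IsNClique n G idv σ ∧ σ ⊆ A ∧ x ∈ chiVerts n δ idv σ}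

/-- `A'` is the subdivision image `χ(A,δ)` of `A ⊆ G`, where `A` is either a set
of terminated vertices (in which case `χ(A,δ) = A`) or a union of `n`-vertex
cliques of `G`. -/
def IsChiImage (n : ℕ) (G : PGraph V) (δ : V → Option O) (idv : V → Fin n)
    (A : Set V) (A' : Set (SubV V n)) : Prop :=
  ((∀ v ∈ A, δ v ≠ none) ∧ A' = Sum.inl '' A) ∨
    (IsCliqueUnionSet n G idv A ∧ A' = chiSetCliques n G δ idv A)

/-- `l` is a (nonempty) walk in `G` from a vertex of `A` to a vertex of `B`. -/
def IsWalkBetween (G : PGraph V) (A B : Set V) (l : List V) : Prop :=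
  l.Chain' G.Adj ∧ (∀ v ∈ l, v ∈ G.verts) ∧
    ∃ h : l ≠ [], l.head h ∈ A ∧ l.getLast h ∈ B

/-- The distance between two sets of vertices: the minimum number of edges of a
path from a vertex of `A` to a vertex of `B` (`∞` if there is no such path). -/
noncomputable def setDist (G : PGraph V) (A B : Set V) : ℕ∞ :=
  sInf {d : ℕ∞ | ∃ l : List V, IsWalkBetween G A B l ∧ (l.length : ℕ∞) = d + 1}

/-- `G` is connected: any two of its vertices are joined by a path. -/
def Connected (G : PGraph V) : Prop :=
  ∀ u ∈ G.verts, ∀ v ∈ G.verts, ∃ l, IsWalkBetween G {u} {v} l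

/-- The list `l` contains an edge both of whose endpoints are active. -/
def HasActiveEdge (δ : V → Option O) (l : List V) : Prop :=
  ∃ l₁ l₂ u v, l = l₁ ++ u :: v :: l₂ ∧ δ u = none ∧ δ v = none


/-- An `n`-vertex clique (a set of `n` process states) represents a
configuration if its vertices are exactly the states of the `n` processes in
that configuration. -/
def Represents {n : ℕ} {I : Type} (σ : Set (PState n I)) (C : Config n I) : Prop :=
  σ = Set.range C.st ∧ ∀ i, (C.st i).pid = i

open Classical in
/-- The identification of a subdivision vertex with a process state: an old
(terminated) vertex is identified with itself, and a pair `(i, τ)` is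
identified with the state of process `p_i` consisting of `i` and the scan
result of `S_t` whose component `j` is the state represented by the vertex of
`τ` with identifier `j` for each `j ∈ id(τ)`, and `−` (i.e. `none`) for
`j ∉ id(τ)`. -/
noncomputable def embedSub {n : ℕ} {I : Type} (t : ℕ) :
    SubV (PState n I) n → PState n I :=
  Sum.elim id (fun p =>
    PState.scanned p.1 t
      (fun j => if h : ∃ w ∈ p.2, PState.pid w = j then some h.choose else none))

theorem stepc_of_hasUpd_eq_false {n : ℕ} {I : Type} {C : Config n I} {i : Fin n}
    (h : (C.st i).hasUpd = false) :
    stepc C i =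
      { mem := Function.update C.mem (C.st i).rounds
          (Function.update (C.mem (C.st i).rounds) i (some (C.st i))),
        st := Function.update C.st i (PState.upd (C.st i)) } := by
  unfold stepc
  split
  · next s hs => simp [hs, PState.hasUpd] at h
  · rfl

theorem stepc_of_eq_upd {n : ℕ} {I : Type} {C : Config n I} {i : Fin n} {s : PState n I}
    (h : C.st i = PState.upd s) :
    stepc C i =
      { C with st := Function.update C.st i (PState.scanned i s.rounds (C.mem s.rounds)) } := by
  unfold stepc
  rw [h]

/-- The scan result in which exactly the components in `U` have been updated, each to the
state of its process in `C`. -/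
def viewOf {n : ℕ} {I : Type} (C : Config n I) (U : Finset (Fin n)) :
    Fin n → Option (PState n I) :=
  fun j => if j ∈ U then some (C.st j) else none

/-- The configuration in the course of round `t` from `C` in which the processes in `U` have
updated `S_t` and those in `S` have also scanned it, process `i` with result `viewOf C (T i)`. -/
def midRound {n : ℕ} {I : Type} (C : Config n I) (t : ℕ) (T : Fin n → Finset (Fin n))
    (U S : Finset (Fin n)) : Config n I where
  mem := Function.update C.mem t (viewOf C U)
  st := fun i =>
    if i ∈ S then PState.scanned i t (viewOf C (T i))
    else if i ∈ U then PState.upd (C.st i) else C.st i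

theorem midRound_empty {n : ℕ} {I : Type} {C : Config n I} {t : ℕ}
    (hfresh : ∀ j, C.mem t j = none) (T : Fin n → Finset (Fin n)) :
    midRound C t T ∅ ∅ = C := by
  have h : viewOf C ∅ = C.mem t := by
    funext j
    simp [viewOf, hfresh]
  simp [midRound, h]

theorem stepc_midRound_update {n : ℕ} {I : Type} {C : Config n I} {t : ℕ}
    {T : Fin n → Finset (Fin n)} {U S : Finset (Fin n)} {i : Fin n}
    (hi : PoisedUpdate C i t) (hU : i ∉ U) (hS : i ∉ S) :
    stepc (midRound C t T U S) i = midRound C t T (insert i U) S := by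
  have hst : (midRound C t T U S).st i = C.st i := by simp [midRound, hU, hS]
  rw [stepc_of_hasUpd_eq_false (by rw [hst]; exact hi.1), hst, hi.2]
  have hv : Function.update (viewOf C U) i (some (C.st i)) = viewOf C (insert i U) := by
    funext j
    by_cases hj : j = i
    · subst hj; simp [viewOf]
    · simp [viewOf, hj]
  have hs : Function.update (midRound C t T U S).st i (PState.upd (C.st i)) =
      (midRound C t T (insert i U) S).st := by
    funext j
    by_cases hj : j = i
    · subst hj; simp [midRound, hS]
    · simp [midRound, hj]
  rw [hs]
  simp [midRound, hv]

theorem stepc_midRound_scan {n : ℕ} {I : Type} {C : Config n I} {t : ℕ}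
    {T : Fin n → Finset (Fin n)} {S : Finset (Fin n)} {i : Fin n}
    (hi : PoisedUpdate C i t) (hT : i ∈ T i) (hS : i ∉ S) :
    stepc (midRound C t T (T i) S) i = midRound C t T (T i) (insert i S) := by
  have hst : (midRound C t T (T i) S).st i = PState.upd (C.st i) := by simp [midRound, hT, hS]
  rw [stepc_of_eq_upd hst, hi.2]
  have hs : Function.update (midRound C t T (T i) S).st i
      (PState.scanned i t ((midRound C t T (T i) S).mem t)) =
      (midRound C t T (T i) (insert i S)).st := by
    funext j
    by_cases hj : j = i
    · subst hj; simp [midRound]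
    · simp [midRound, hj]
  rw [hs]
  simp [midRound]

/-- A family of pairwise comparable sets `T i ∋ i` of active processes is the family of scan
results of some 1-round schedule. -/
theorem exists_oneRound_of_chain {n : ℕ} {I : Type} {δ : PState n I → Option O}
    (hδ : ∀ s : PState n I, δ s ≠ none → s.isScanned = true)
    {C : Config n I} {t : ℕ} {A : Finset (Fin n)}
    (hA : ∀ i, i ∈ A ↔ δ (C.st i) = none)
    (hpoised : ∀ i ∈ A, PoisedUpdate C i t) (hfresh : ∀ j, C.mem t j = none)
    {T : Fin n → Finset (Fin n)} (hself : ∀ i ∈ A, i ∈ T i) (hsub : ∀ i ∈ A, T i ⊆ A)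
    (hchain : ∀ i ∈ A, ∀ j ∈ A, T i ⊆ T j ∨ T j ⊆ T i) :
    ∃ β, IsOneRound δ C β ∧ runSched C β = midRound C t T A A := by
  have hupd : ∀ s : PState n I, δ (PState.upd s) = none := fun s => by
    by_contra h
    simpa [PState.isScanned] using hδ _ h
  have extend : ∀ k : ℕ, ∀ U S : Finset (Fin n), S ⊆ U → U ⊆ A →
      (∀ i ∈ A, i ∉ S → U ⊆ T i) → (A \ U).card + (A \ S).card = k →
      ∃ β, IsSched δ (midRound C t T U S) β ∧
        (∀ i, β.count i = (if i ∈ A \ U then 1 else 0) + (if i ∈ A \ S then 1 else 0)) ∧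
        runSched (midRound C t T U S) β = midRound C t T A A := by
    intro k
    induction k with
    | zero =>
      intro U S hSU hUA hUT hk
      have hU : A \ U = ∅ := Finset.card_eq_zero.1 (by omega)
      have hS : A \ S = ∅ := Finset.card_eq_zero.1 (by omega)
      have hUeq : U = A := hUA.antisymm (Finset.sdiff_eq_empty_iff_subset.1 hU)
      have hSeq : S = A := (hSU.trans hUA).antisymm (Finset.sdiff_eq_empty_iff_subset.1 hS)
      subst hUeq hSeq
      exact ⟨[], trivial, by simp, rfl⟩
    | succ k ih =>
      intro U S hSU hUA hUT hk
      have hne : (A \ S).Nonempty := by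
        rw [Finset.nonempty_iff_ne_empty]
        intro h
        have hUS : A \ U ⊆ A \ S := Finset.sdiff_subset_sdiff subset_rfl hSU
        rw [h, Finset.subset_empty] at hUS
        simp [h, hUS] at hk
      obtain ⟨i, hi, hmin⟩ := Finset.exists_min_image (A \ S) (fun i => (T i).card) hne
      obtain ⟨hiA, hiS⟩ := Finset.mem_sdiff.1 hi
      have hle : ∀ j ∈ A, j ∉ S → T i ⊆ T j := fun j hjA hjS => by
        rcases hchain i hiA j hjA with h | h
        · exact h
        · exact (Finset.eq_of_subset_of_card_le h (hmin j (Finset.mem_sdiff.2 ⟨hjA, hjS⟩))).ge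
      have card_insert : ∀ W : Finset (Fin n), ∀ x ∈ A, x ∉ W →
          (A \ insert x W).card + 1 = (A \ W).card := fun W x hxA hxW => by
        rw [Finset.sdiff_insert]
        exact Finset.card_erase_add_one (Finset.mem_sdiff.2 ⟨hxA, hxW⟩)
      by_cases hUi : U = T i
      · subst hUi
        obtain ⟨β, hβ, hcount, hrun⟩ := ih (T i) (insert i S)
          (Finset.insert_subset (hself i hiA) hSU) hUA
          (fun j hjA hj => hle j hjA fun h => hj (Finset.mem_insert_of_mem h))
          (by have := card_insert S i hiA hiS; omega)
        have hstep := stepc_midRound_scan (T := T) (hpoised i hiA) (hself i hiA) hiS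
        refine ⟨i :: β, ⟨?_, by rwa [hstep]⟩, fun j => ?_, ?_⟩
        · simp [midRound, hself i hiA, hiS, hupd]
        · rw [List.count_cons, hcount]
          by_cases hj : j = i
          · subst hj; simp [hiA, hiS]
          · simp [hj, Ne.symm hj]
        · rw [runSched, hstep, hrun]
      · obtain ⟨x, hxT, hxU⟩ : ∃ x ∈ T i, x ∉ U := by
          by_contra! h
          exact hUi ((hUT i hiA hiS).antisymm h)
        have hxA := hsub i hiA hxT
        have hxS : x ∉ S := fun h => hxU (hSU h)
        obtain ⟨β, hβ, hcount, hrun⟩ := ih (insert x U) S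
          (hSU.trans (Finset.subset_insert _ _)) (Finset.insert_subset hxA hUA)
          (fun j hjA hj => Finset.insert_subset (hle j hjA hj hxT) (hUT j hjA hj))
          (by have := card_insert U x hxA hxU; omega)
        have hstep := stepc_midRound_update (T := T) (hpoised x hxA) hxU hxS
        refine ⟨x :: β, ⟨?_, by rwa [hstep]⟩, fun j => ?_, ?_⟩
        · simpa [midRound, hxU, hxS] using (hA x).1 hxA
        · rw [List.count_cons, hcount]
          by_cases hj : j = x
          · subst hj; simp [hxA, hxU, hxS]
          · simp [hj, Ne.symm hj]
        · rw [runSched, hstep, hrun]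
  obtain ⟨β, hβ, hcount, hrun⟩ := extend _ ∅ ∅ subset_rfl (Finset.empty_subset _)
    (fun _ _ _ => Finset.empty_subset _) rfl
  rw [midRound_empty hfresh] at hβ hrun
  refine ⟨β, ⟨hβ, fun i => ?_⟩, hrun⟩
  rw [hcount]
  by_cases hi : δ (C.st i) = none
  · simp [(hA i).2 hi, hi]
  · simp [mt (hA i).1 hi, hi]

theorem IsNClique.exists_id_eq {V : Type} {n : ℕ} {G : PGraph V} {idv : V → Fin n} {κ : Set V}
    (h : IsNClique n G idv κ) (i : Fin n) : ∃ x ∈ κ, idv x = i := by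
  have himg : idv '' κ = Set.univ := by
    apply Set.eq_of_subset_of_ncard_le (Set.subset_univ _)
    rw [h.2.2.2.2.ncard_image, h.2.2.1, Set.ncard_univ, Nat.card_fin]
  exact himg.ge (Set.mem_univ i)

/-- Let `σ` be an `n`-vertex clique that represents a
configuration `C` of an NIS protocol in which every active process is poised to
update the snapshot object `S_{t+1}` (here indexed by `t`, i.e. `C.mem t`).
Then every `n`-vertex clique of `χ(σ,δ)` represents a configuration reachable
from `C` by a 1-round schedule. -/
theorem clique_is_one_round_config {n : ℕ} {I O : Type} (hn : 2 ≤ n)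
    (δ : PState n I → Option O)
    (hδ : ∀ s : PState n I, δ s ≠ none → s.isScanned = true)
    (σ : Set (PState n I)) (C : Config n I) (t : ℕ)
    (hrep : Represents σ C)
    (hpoised : ∀ i, δ (C.st i) = none → PoisedUpdate C i t)
    (hfresh : ∀ j, C.mem t j = none) :
    ∀ κ : Set (SubV (PState n I) n),
      IsNClique n (chiCliqueGraph n δ PState.pid σ) (subId n PState.pid) κ →
      ∃ β, IsOneRound δ C β ∧ Represents (embedSub t '' κ) (runSched C β) := by
  classical
  intro κ hκ
  obtain ⟨rfl, hpid⟩ := hrep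
  have hinj : ∀ i j, (C.st i).pid = j → i = j := fun i j h => (hpid i).symm.trans h
  choose x hxκ hxid using hκ.exists_id_eq
  have hκx : κ = Set.range x := by
    ext y
    refine ⟨fun hy => ⟨_, hκ.2.2.2.2 (hxκ _) hy (hxid (subId n PState.pid y))⟩, ?_⟩
    rintro ⟨i, rfl⟩
    exact hxκ i
  have hterm : ∀ i, δ (C.st i) ≠ none → x i = Sum.inl (C.st i) := by
    intro i hi
    rcases hκ.1 (hxκ i) with ⟨v, ⟨j, rfl⟩, -, hx⟩ | ⟨j, τ, hτ, ⟨w, hw, hwj⟩, hx⟩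
    · have hid := hxid i
      rw [hx] at hid
      rw [hx, hinj j i hid]
    · have hid := hxid i
      rw [hx] at hid
      obtain ⟨⟨k, rfl⟩, hk⟩ := hτ hw
      exact absurd (hinj k i (hwj.trans hid) ▸ hk) hi
  have hact : ∀ i, ∃ τ : Set (PState n I), δ (C.st i) = none →
      x i = Sum.inr (i, τ) ∧ τ ⊆ {v ∈ Set.range C.st | δ v = none} ∧ C.st i ∈ τ := by
    intro i
    by_cases hi : δ (C.st i) = none
    · rcases hκ.1 (hxκ i) with ⟨v, ⟨j, rfl⟩, hj, hx⟩ | ⟨j, τ, hτ, ⟨w, hw, hwj⟩, hx⟩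
      · have hid := hxid i
        rw [hx] at hid
        exact absurd hi (hinj j i hid ▸ hj)
      · have hid : j = i := by simpa [hx, subId] using hxid i
        subst hid
        obtain ⟨⟨k, rfl⟩, -⟩ := hτ hw
        exact ⟨τ, fun _ => ⟨hx, hτ, hinj k j hwj ▸ hw⟩⟩
    · exact ⟨∅, fun h => absurd h hi⟩
  choose τ hτ using hact
  obtain ⟨β, hβ, hrun⟩ := exists_oneRound_of_chain (A := {i | δ (C.st i) = none}) (t := t)
    (T := fun i => {j | C.st j ∈ τ i}) hδ (by simp) (by simpa using hpoised) hfresh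
    (by simpa using fun i hi => (hτ i hi).2.2)
    (by
      intro i hi j hj
      simp only [Finset.mem_filter, Finset.mem_univ, true_and] at hi hj ⊢
      exact ((hτ i hi).2.1 hj).2)
    (by
      intro i hi j hj
      simp only [Finset.mem_filter, Finset.mem_univ, true_and] at hi hj
      have hcomp : τ i ⊆ τ j ∨ τ j ⊆ τ i := by
        by_cases hij : i = j
        · exact Or.inl (hij ▸ subset_rfl)
        · have hadj := hκ.2.2.2.1 _ (hxκ i) _ (hxκ j)
            (fun h => hij (by rw [← hxid i, h, hxid j]))
          rcases hadj.2.2.2 with ⟨v, hv⟩ | ⟨v, hv⟩ | ⟨a, τ₁, b, τ₂, ha, hb, hab⟩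
          · simp [(hτ i hi).1] at hv
          · simp [(hτ j hj).1] at hv
          · simp only [(hτ i hi).1, (hτ j hj).1, Sum.inr.injEq, Prod.mk.injEq] at ha hb
            rwa [ha.2, hb.2]
      refine hcomp.imp (fun h k hk => ?_) fun h k hk => ?_ <;>
        simp only [Finset.mem_filter, Finset.mem_univ, true_and] at hk ⊢ <;> exact h hk)
  have hst : ∀ i, embedSub t (x i) = (runSched C β).st i := by
    intro i
    rw [hrun]
    by_cases hi : δ (C.st i) = none
    · rw [(hτ i hi).1]
      simp only [embedSub, Sum.elim_inr, midRound, Finset.mem_filter, Finset.mem_univ, true_and,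
        hi, if_true]
      congr 1
      funext j
      have hmem : ∀ w ∈ τ i, w.pid = j → w = C.st j := by
        intro w hw hwj
        obtain ⟨⟨k, rfl⟩, -⟩ := (hτ i hi).2.1 hw
        rw [hinj k j hwj]
      by_cases hj : C.st j ∈ τ i
      · have hex : ∃ w ∈ τ i, w.pid = j := ⟨_, hj, hpid j⟩
        rw [dif_pos hex, viewOf, if_pos (by simpa using hj),
          hmem _ hex.choose_spec.1 hex.choose_spec.2]
      · rw [dif_neg fun ⟨w, hw, hwj⟩ => hj (hmem w hw hwj ▸ hw), viewOf,
          if_neg (by simpa using hj)]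
    · rw [hterm i hi]
      simp [embedSub, midRound, hi]
  refine ⟨β, hβ, ?_, fun i => ?_⟩
  · rw [hκx, ← Set.range_comp]
    exact congrArg Set.range (funext hst)
  · rw [hrun]
    by_cases hi : δ (C.st i) = none
    · simp [midRound, hi, PState.pid]
    · simpa [midRound, hi] using hpid i

end EBP
end
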